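/- For every integer r ≥ 2, the probability that a uniformly random permutation Π_n of [n] contains r-twins of length at least ⌈2e · n^{r/(2r−1)}⌉ tends to 0 as n → ∞; in other words, asymptotically almost surely t^(r)(Π_n) ≤ 2e · n^{r/(2r−1)}. -/

import Mathlib

/-- `r`-twins of length `k` in a permutation `π` of `[n]` (modeled as `Fin n`):
`r` subsequences of `π`, given by their strictly increasing position maps `p j`,
occupying pairwise disjoint sets of positions, whose value sequences are pairwise
similar (i.e., have the same relative order). -/
def HasTwins (r k n : ℕ) (π : Equiv.Perm (Fin n)) : Prop :=
  ∃ p : Fin r → Fin k → Fin n,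
    (∀ j, StrictMono (p j)) ∧
    (∀ j j', j ≠ j' → ∀ i i', p j i ≠ p j' i') ∧
    (∀ j j' i i', π (p j i) < π (p j i') ↔ π (p j' i) < π (p j' i'))

/-- A permutation of the index set of an injective family in a well-order which preserves the
relative order of the family is the identity. -/
theorem perm_eq_one_of_lt_iff_lt {α β : Type*} [LinearOrder β] [WellFoundedLT β] {f : α → β}
    (hf : Function.Injective f) (σ : Equiv.Perm α)
    (h : ∀ i i', f (σ i) < f (σ i') ↔ f i < f i') : σ = 1 := by
  let f' : α ↪ β := ⟨f, hf⟩
  have : IsWellOrder α (Order.Preimage f' (· < ·)) := (RelEmbedding.preimage f' (· < ·)).isWellOrder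
  let e : (Order.Preimage f' (· < ·)) ≃r (Order.Preimage f' (· < ·)) := ⟨σ, h _ _⟩
  have he : e.toInitialSeg = InitialSeg.refl _ := Subsingleton.elim _ _
  ext1 i
  exact congrArg (fun g : InitialSeg _ _ => g i) he

/-- The permutations of `α` acting on disjoint sequences `p j` by permuting the entries of each. -/
theorem exists_perm_block_action {ι κ α : Type*} (p : ι → κ ↪ α)
    (hp : ∀ j j', j ≠ j' → ∀ i i', p j i ≠ p j' i') :
    ∃ φ : (ι → Equiv.Perm κ) →* Equiv.Perm α, ∀ σ j i, φ σ (p j i) = p j (σ j i) := by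
  let P : (Σ _ : ι, κ) ↪ α := ⟨fun x => p x.1 x.2, by
    rintro ⟨j, i⟩ ⟨j', i'⟩ h
    by_cases hj : j = j'
    · subst hj
      simpa using h
    · exact (hp j j' hj i i' h).elim⟩
  refine ⟨(Equiv.Perm.viaEmbeddingHom P).comp (Equiv.Perm.sigmaCongrRightHom fun _ => κ), ?_⟩
  intro σ j i
  exact Equiv.Perm.viaEmbedding_apply _ P ⟨j, i⟩

open scoped Classical in
/-- At most a proportion `1 / (k!) ^ s` of all permutations have pairwise similar values along
`s + 1` given disjoint position sequences of length `k`. -/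
theorem card_similar_mul_factorial_pow_le {s k n : ℕ} (p : Fin (s + 1) → Fin k ↪ Fin n)
    (hp : ∀ j j', j ≠ j' → ∀ i i', p j i ≠ p j' i') :
    (Finset.univ.filter fun π : Equiv.Perm (Fin n) =>
      ∀ j j' i i', π (p j i) < π (p j i') ↔ π (p j' i) < π (p j' i')).card * k.factorial ^ s
      ≤ n.factorial := by
  obtain ⟨φ, hφ⟩ := exists_perm_block_action p hp
  set S := Finset.univ.filter fun π : Equiv.Perm (Fin n) =>
      ∀ j j' i i', π (p j i) < π (p j i') ↔ π (p j' i) < π (p j' i') with hS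
  let c : (Fin s → Equiv.Perm (Fin k)) → Fin (s + 1) → Equiv.Perm (Fin k) :=
    fun σ => Fin.cons 1 σ
  have hinj : Function.Injective
      (fun x : S × (Fin s → Equiv.Perm (Fin k)) => (x.1 : Equiv.Perm (Fin n)) * φ (c x.2)) := by
    rintro ⟨⟨π, hπ⟩, σ⟩ ⟨⟨π', hπ'⟩, σ'⟩ h
    simp only [hS, Finset.mem_filter, Finset.mem_univ, true_and] at hπ hπ' h
    have h1 : π = π' * φ (c σ' * (c σ)⁻¹) := by
      rw [map_mul, map_inv, ← mul_assoc, ← h, mul_inv_cancel_right]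
    have h0 : (c σ' * (c σ)⁻¹) 0 = 1 := by simp [c]
    have h2 : c σ' * (c σ)⁻¹ = 1 := by
      funext j
      refine perm_eq_one_of_lt_iff_lt (π'.injective.comp (p j).injective) _ fun i i' => ?_
      have key := hπ j 0 i i'
      rw [h1] at key
      simp only [Equiv.Perm.mul_apply, hφ, h0, Equiv.Perm.one_apply] at key
      exact key.trans (hπ' 0 j i i')
    have h3 : c σ' = c σ := mul_inv_eq_one.mp h2
    have h4 : σ' = σ := (Fin.cons_injective2 h3).2
    rw [h2, map_one, mul_one] at h1
    simp [h1, h4]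
  have := Fintype.card_le_of_injective _ hinj
  simpa [Fintype.card_perm] using this

/-- Shortening twins. -/
theorem HasTwins.mono {r k k' n : ℕ} {π : Equiv.Perm (Fin n)} (h : HasTwins r k n π)
    (hk : k' ≤ k) : HasTwins r k' n π := by
  obtain ⟨p, h1, h2, h3⟩ := h
  exact ⟨fun j i => p j (Fin.castLE hk i), fun j => (h1 j).comp (Fin.strictMono_castLE hk),
    fun j j' hj i i' => h2 j j' hj _ _, fun j j' i i' => h3 j j' _ _⟩

open scoped Classical in
/-- The union bound for the number of permutations containing `(s + 1)`-twins of length `k`. -/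
theorem card_hasTwins_mul_factorial_pow_le (s k n : ℕ) :
    (Finset.univ.filter fun π : Equiv.Perm (Fin n) => HasTwins (s + 1) k n π).card
      * k.factorial ^ s ≤ n.choose k ^ (s + 1) * n.factorial := by
  let F : (Fin (s + 1) → Fin k ↪o Fin n) → Finset (Equiv.Perm (Fin n)) := fun p =>
    Finset.univ.filter fun π : Equiv.Perm (Fin n) =>
      ∀ j j' i i', π (p j i) < π (p j i') ↔ π (p j' i) < π (p j' i')
  let T : Finset (Fin (s + 1) → Fin k ↪o Fin n) :=
    Finset.univ.filter fun p => ∀ j j', j ≠ j' → ∀ i i', p j i ≠ p j' i'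
  have hsub : (Finset.univ.filter fun π : Equiv.Perm (Fin n) => HasTwins (s + 1) k n π)
      ⊆ T.biUnion F := by
    intro π hπ
    obtain ⟨p, h1, h2, h3⟩ := (Finset.mem_filter.mp hπ).2
    refine Finset.mem_biUnion.mpr ⟨fun j => OrderEmbedding.ofStrictMono (p j) (h1 j), ?_, ?_⟩
    · simpa [T] using h2
    · exact Finset.mem_filter.mpr ⟨Finset.mem_univ _, h3⟩
  have hT : T.card ≤ n.choose k ^ (s + 1) := by
    refine (Finset.card_le_univ T).trans (le_of_eq ?_)
    have : Fintype.card (Fin k ↪o Fin n) = n.choose k := by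
      rw [← Nat.card_eq_fintype_card, Nat.card_congr Set.powersetCard.ofFinEmbEquiv,
        Set.powersetCard.card, Nat.card_fin]
    simp [this]
  calc _ ≤ (∑ p ∈ T, (F p).card) * k.factorial ^ s := by
        gcongr
        exact (Finset.card_le_card hsub).trans Finset.card_biUnion_le
    _ = ∑ p ∈ T, (F p).card * k.factorial ^ s := Finset.sum_mul ..
    _ ≤ ∑ p ∈ T, n.factorial := by
        refine Finset.sum_le_sum fun p hp => ?_
        exact card_similar_mul_factorial_pow_le (fun j => (p j).toEmbedding)
          (by simpa [T] using hp)
    _ ≤ _ := by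
        rw [Finset.sum_const, smul_eq_mul]
        gcongr

/-- If `2 e n ^ ((s + 1) / (2 s + 1)) ≤ k`, then the union bound for the probability of
`(s + 1)`-twins of length `k` is at most `2 ^ (-k)`. -/
theorem choose_pow_div_factorial_pow_le {s k n : ℕ} (hn : 0 < n)
    (hk : 2 * Real.exp 1 * (n : ℝ) ^ (((s : ℝ) + 1) / (2 * s + 1)) ≤ k) :
    (n.choose k : ℝ) ^ (s + 1) / (k.factorial : ℝ) ^ s ≤ (1 / 2) ^ k := by
  set x : ℝ := (n : ℝ) ^ (((s : ℝ) + 1) / (2 * s + 1)) with hx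
  have hn' : (0 : ℝ) < n := by exact_mod_cast hn
  have hx0 : 0 < x := by positivity
  have hk0 : (0 : ℝ) < k := lt_of_lt_of_le (by positivity) hk
  have hxn : x ^ (2 * s + 1) = (n : ℝ) ^ (s + 1) := by
    rw [hx, ← Real.rpow_natCast, ← Real.rpow_mul hn'.le, ← Real.rpow_natCast]
    congr 1
    push_cast
    field_simp
  have hf : (0 : ℝ) < k.factorial := by positivity
  have hfac : 1 / (k.factorial : ℝ) ≤ (Real.exp 1 / k) ^ k := by
    have h := Real.pow_div_factorial_le_exp (k : ℝ) hk0.le k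
    rw [div_pow, ← Real.exp_nat_mul, mul_one, le_div_iff₀ (by positivity)]
    calc _ = (k : ℝ) ^ k / k.factorial := by ring
      _ ≤ _ := h
  have hhalf : x * (Real.exp 1 / k) ≤ 1 / 2 := by
    rw [← mul_div_assoc, div_le_div_iff₀ hk0 two_pos]
    linarith
  calc (n.choose k : ℝ) ^ (s + 1) / (k.factorial : ℝ) ^ s
      ≤ ((n : ℝ) ^ k / k.factorial) ^ (s + 1) / (k.factorial : ℝ) ^ s := by
        gcongr
        exact Nat.choose_le_pow_div k n
    _ = ((n : ℝ) ^ (s + 1)) ^ k * (1 / (k.factorial : ℝ)) ^ (2 * s + 1) := by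
        rw [div_pow, ← pow_mul, ← pow_mul, mul_comm k (s + 1), one_div, inv_pow, two_mul,
          div_div, ← pow_add, div_eq_mul_inv]
        congr 3
        ring
    _ ≤ ((n : ℝ) ^ (s + 1)) ^ k * ((Real.exp 1 / k) ^ k) ^ (2 * s + 1) := by gcongr
    _ = ((x * (Real.exp 1 / k)) ^ (2 * s + 1)) ^ k := by
        rw [← hxn]
        ring
    _ ≤ ((1 / 2) ^ (2 * s + 1)) ^ k := by gcongr
    _ ≤ ((1 / 2) ^ 1) ^ k := by
        gcongr ?_ ^ k
        exact pow_le_pow_of_le_one (by norm_num) (by norm_num) (by omega)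
    _ = (1 / 2) ^ k := by rw [pow_one]

/-- Upper bound of Theorem 2: for every `r ≥ 2`, the probability that a uniformly
random permutation of `[n]` contains `r`-twins of length at least
`⌈2e · n^(r/(2r-1))⌉` tends to `0` as `n → ∞`. -/
theorem random_twins_upper_bound (r : ℕ) (hr : 2 ≤ r) :
    Filter.Tendsto
      (fun n : ℕ =>
        (Nat.card {π : Equiv.Perm (Fin n) //
            ∃ k : ℕ, ⌈2 * Real.exp 1 * (n : ℝ) ^ ((r : ℝ) / (2 * (r : ℝ) - 1))⌉₊ ≤ k ∧
              HasTwins r k n π} : ℝ) / (n.factorial : ℝ))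
      Filter.atTop (nhds 0) := by
  classical
  obtain ⟨s, rfl⟩ : ∃ s, r = s + 1 := ⟨r - 1, by omega⟩
  have hexp : ((s + 1 : ℕ) : ℝ) / (2 * ((s + 1 : ℕ) : ℝ) - 1) = ((s : ℝ) + 1) / (2 * s + 1) := by
    push_cast
    ring_nf
  rw [hexp]
  set K : ℕ → ℕ := fun n =>
    ⌈2 * Real.exp 1 * (n : ℝ) ^ (((s : ℝ) + 1) / (2 * s + 1))⌉₊ with hK
  have hKtop : Filter.Tendsto K Filter.atTop Filter.atTop := by
    refine tendsto_nat_ceil_atTop.comp (Filter.Tendsto.const_mul_atTop (by positivity) ?_)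
    exact (tendsto_rpow_atTop (by positivity)).comp tendsto_natCast_atTop_atTop
  have hlim : Filter.Tendsto (fun n => (1 / 2 : ℝ) ^ K n) Filter.atTop (nhds 0) :=
    (tendsto_pow_atTop_nhds_zero_of_lt_one (by norm_num) (by norm_num)).comp hKtop
  refine squeeze_zero' (Filter.Eventually.of_forall fun n => by positivity) ?_ hlim
  filter_upwards [Filter.eventually_gt_atTop 0] with n hn
  refine le_trans ?_ (choose_pow_div_factorial_pow_le hn (Nat.le_ceil _))
  have hcard : Nat.card {π : Equiv.Perm (Fin n) // ∃ k : ℕ, K n ≤ k ∧ HasTwins (s + 1) k n π}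
      = (Finset.univ.filter fun π : Equiv.Perm (Fin n) => HasTwins (s + 1) (K n) n π).card := by
    rw [Nat.card_eq_fintype_card, Fintype.card_subtype]
    congr 1
    ext π
    simp only [Finset.mem_filter, Finset.mem_univ, true_and]
    exact ⟨fun ⟨k, hk, h⟩ => h.mono hk, fun h => ⟨_, le_rfl, h⟩⟩
  rw [hcard, div_le_div_iff₀ (by positivity) (by positivity)]
  exact_mod_cast card_hasTwins_mul_factorial_pow_le s (K n) n
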